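/- arXiv:2009.08191 — 2 statements merged into one kernel-verified Lean document; each statement's English description precedes it below -/
import Mathlib

section
/- Let τ and τ' be permutations of the vectors of F^r and F^{r'} respectively, each fixing the all-zero vector. If SQS_τ and SQS_{τ'} are point transitive Steiner quadruple systems of orders 2^{r+1} and 2^{r'+1}, then SQS_{τ|τ'} is a point transitive Steiner quadruple system of order 2^{r+r'+1}, where τ|τ' is the permutation of F^{r+r'} given by (τ|τ')(x|y) = τ(x)|τ'(y). -/
open Finset

/-- `V r` is the vector space `F^r` over `F = GF(2)`. -/
abbrev V (r : ℕ) : Type := Fin r → ZMod 2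

/-- The point set of `SQS_τ` (and the coordinate set of codes of length `2^{r+1}`):
left-half points `({a},∅)` are `Sum.inl a`, right-half points `(∅,{a})` are `Sum.inr a`. -/
abbrev Pt (r : ℕ) : Type := V r ⊕ V r

/-- Action of a coordinate permutation `π` on a word: `π(y)_i = y_{π⁻¹(i)}`. -/
def permAct {ι : Type} (π : Equiv.Perm ι) (y : ι → ZMod 2) : ι → ZMod 2 :=
  fun i => y (π.symm i)

/-- The extended Hamming code of length `2^r`, with coordinates indexed by the vectors
of `F^r`: all even weight words whose support sums to zero. -/
def extHamming (r : ℕ) : Set (V r → ZMod 2) :=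
  {x | ∑ a : V r, x a • a = 0 ∧ ∑ a : V r, x a = 0}

/-- `e_a` : the weight-one word with support `{a}`. -/
def unitVec {r : ℕ} (a : V r) : V r → ZMod 2 :=
  fun b => if b = a then 1 else 0

/-- The code `S_τ = ⋃_{a ∈ F^r} (H + e_a + e_0) × (H + e_{τ(a)} + e_0)` of length `2^{r+1}`. -/
def Scode {r : ℕ} (τ : Equiv.Perm (V r)) : Set (Pt r → ZMod 2) :=
  ⋃ a : V r, {z | ∃ h₁ ∈ extHamming r, ∃ h₂ ∈ extHamming r,
    z = Sum.elim (h₁ + unitVec a + unitVec 0) (h₂ + unitVec (τ a) + unitVec 0)}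

/-- `Q_0` : quadruples `({a,b,c,d},∅)`, `a,b,c,d` pairwise distinct, `a+b+c+d=0`. -/
def Q0 (r : ℕ) : Set (Finset (Pt r)) :=
  {q | ∃ a b c d : V r, a ≠ b ∧ a ≠ c ∧ a ≠ d ∧ b ≠ c ∧ b ≠ d ∧ c ≠ d ∧
    a + b + c + d = 0 ∧ q = {Sum.inl a, Sum.inl b, Sum.inl c, Sum.inl d}}

/-- `Q_1` : quadruples `(∅,{a,b,c,d})`, `a,b,c,d` pairwise distinct, `a+b+c+d=0`. -/
def Q1 (r : ℕ) : Set (Finset (Pt r)) :=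
  {q | ∃ a b c d : V r, a ≠ b ∧ a ≠ c ∧ a ≠ d ∧ b ≠ c ∧ b ≠ d ∧ c ≠ d ∧
    a + b + c + d = 0 ∧ q = {Sum.inr a, Sum.inr b, Sum.inr c, Sum.inr d}}

/-- `Q_τ` : quadruples `({a,c},{b,d})` with `τ(a+c) = b+d ≠ 0`. -/
def Qt {r : ℕ} (τ : Equiv.Perm (V r)) : Set (Finset (Pt r)) :=
  {q | ∃ a b c d : V r, τ (a + c) = b + d ∧ b + d ≠ 0 ∧
    q = {Sum.inl a, Sum.inl c, Sum.inr b, Sum.inr d}}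

/-- The Steiner quadruple system `SQS_τ = Q_0 ∪ Q_1 ∪ Q_τ`. -/
def SQS {r : ℕ} (τ : Equiv.Perm (V r)) : Set (Finset (Pt r)) :=
  Q0 r ∪ Q1 r ∪ Qt τ

/-- Action of a point bijection on a set system. -/
def qAct {α β : Type} [DecidableEq β] (π : α ≃ β) (Q : Set (Finset α)) : Set (Finset β) :=
  (fun q => q.image π) '' Q

/-- All quadruples of the system `Q` containing both points `p` and `p'`. -/
def quadsThrough {r : ℕ} (Q : Set (Finset (Pt r))) (p p' : Pt r) : Set (Finset (Pt r)) :=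
  {q ∈ Q | p ∈ q ∧ p' ∈ q}

/-- The affine permutation `σ_{a,A} : b ↦ a + A b` of `F^r`, where `A ∈ GL(r,2)`. -/
def affEquiv {r : ℕ} (a : V r) (A : V r ≃ₗ[ZMod 2] V r) : Equiv.Perm (V r) :=
  A.toEquiv.trans (Equiv.addLeft a)

/-- The permutation `ξ` swapping `({a},∅)` with `(∅,{a})` for every `a`. -/
def xi (r : ℕ) : Equiv.Perm (Pt r) := Equiv.sumComm (V r) (V r)

/-- Point transitivity of the Steiner quadruple system `SQS_τ`. -/
def SQSPointTransitive {r : ℕ} (τ : Equiv.Perm (V r)) : Prop :=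
  ∀ p p' : Pt r, ∃ π : Equiv.Perm (Pt r), qAct π (SQS τ) = SQS τ ∧ π p = p'

/-- A code is transitive if (a subgroup of) its automorphism group acts transitively
on its codewords: any codeword is mapped to any other by an automorphism `y ↦ x + π(y)`. -/
def IsTransitiveCode {ι : Type} (C : Set (ι → ZMod 2)) : Prop :=
  ∀ c ∈ C, ∀ c' ∈ C, ∃ (x : ι → ZMod 2) (π : Equiv.Perm ι),
    (fun y => x + permAct π y) '' C = C ∧ x + permAct π c = c'

/-- A code is coordinate transitive if `PAut(C)` acts transitively on coordinates. -/
def CoordTransitive {ι : Type} (C : Set (ι → ZMod 2)) : Prop :=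
  ∀ i j : ι, ∃ π : Equiv.Perm ι, permAct π '' C = C ∧ π i = j

/-- `C_1` : the words at Hamming distance exactly 1 from the code `C`. -/
def codeNbrs {ι : Type} [Fintype ι] (C : Set (ι → ZMod 2)) : Set (ι → ZMod 2) :=
  {y | y ∉ C ∧ ∃ c ∈ C, hammingDist y c = 1}

/-- A code is neighbor transitive if `Aut(C)` acts transitively both on `C` and on `C_1`. -/
def NeighborTransitive {ι : Type} [Fintype ι] (C : Set (ι → ZMod 2)) : Prop :=
  IsTransitiveCode C ∧
  ∀ y ∈ codeNbrs C, ∀ y' ∈ codeNbrs C, ∃ (x : ι → ZMod 2) (π : Equiv.Perm ι),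
    (fun w => x + permAct π w) '' C = C ∧ x + permAct π y = y'

/-- An extended perfect code: minimum distance 4 and `2^n/(2n)` codewords. -/
def IsExtPerfect {ι : Type} [Fintype ι] (C : Set (ι → ZMod 2)) : Prop :=
  (∀ x ∈ C, ∀ y ∈ C, x ≠ y → 4 ≤ hammingDist x y) ∧
  (∃ x ∈ C, ∃ y ∈ C, hammingDist x y = 4) ∧
  Nat.card C * (2 * Fintype.card ι) = 2 ^ Fintype.card ι

/-- The (extended) Mollard code `M(C,D)` with function `φ`. -/
def mollard {t m : ℕ} (C : Set (Fin t → ZMod 2)) (D : Set (Fin m → ZMod 2))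
    (φ : (Fin t → ZMod 2) → (Fin m → ZMod 2)) : Set (Fin t × Fin m → ZMod 2) :=
  {z | (fun i => ∑ j, z (i, j)) ∈ C ∧
       ∃ d ∈ D, (fun j => ∑ i, z (i, j)) = φ (fun i => ∑ j, z (i, j)) + d}

/-- Isomorphism of codes over possibly different coordinate sets:
`D = x + π(C)` for a coordinate bijection `π` and a vector `x`. -/
def CodeIso {ι κ : Type} (C : Set (ι → ZMod 2)) (D : Set (κ → ZMod 2)) : Prop :=
  ∃ (e : ι ≃ κ) (x : κ → ZMod 2), (fun z => x + fun k => z (e.symm k)) '' C = D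

/-- The rank of a code: the dimension of its linear span. -/
noncomputable def codeRank {ι : Type} (C : Set (ι → ZMod 2)) : ℕ :=
  Module.finrank (ZMod 2) ↥(Submodule.span (ZMod 2) C)

/-- The kernel of a code: `{x : x + C = C}`. -/
def codeKernel {ι : Type} (C : Set (ι → ZMod 2)) : Set (ι → ZMod 2) :=
  {x | (fun y => x + y) '' C = C}

/-- The dimension of the kernel of a code. -/
noncomputable def kernelDim {ι : Type} (C : Set (ι → ZMod 2)) : ℕ :=
  codeRank (codeKernel C)

/-- A permutation of `F^r` is affine if it is of the form `b ↦ a + A b`, `A ∈ GL(r,2)`. -/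
def IsAffinePerm {r : ℕ} (g : Equiv.Perm (V r)) : Prop :=
  ∃ (a : V r) (A : V r ≃ₗ[ZMod 2] V r), ∀ x, g x = a + A x

/-- A regular subgroup of `GA(r,2)`: a subgroup consisting of affine permutations that
acts sharply transitively on `F^r`. -/
def IsRegularAffineSubgroup {r : ℕ} (G : Subgroup (Equiv.Perm (V r))) : Prop :=
  (∀ g ∈ G, IsAffinePerm g) ∧ ∀ u v : V r, ∃! g : G, (g : Equiv.Perm (V r)) u = v

/-- `τ` is induced by an automorphism `T` of a regular subgroup `G ≤ GA(r,2)`: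
`T(g_a) = g_{τ(a)}`, i.e. `τ(g(0)) = (T g)(0)` for every `g ∈ G`. -/
def InducedByRegularAut {r : ℕ} (τ : Equiv.Perm (V r)) : Prop :=
  ∃ G : Subgroup (Equiv.Perm (V r)), IsRegularAffineSubgroup G ∧
    ∃ T : G ≃* G, ∀ g : G, τ ((g : Equiv.Perm (V r)) 0) = (T g : Equiv.Perm (V r)) 0

/-- The identification `F^{r+r'} ≃ F^r × F^{r'}`, `x|y ↦ (x,y)`. -/
def splitEquiv (r r' : ℕ) : V (r + r') ≃ V r × V r' :=
  (finSumFinEquiv.symm.arrowCongr (Equiv.refl (ZMod 2))).trans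
    (Equiv.sumArrowEquivProdArrow _ _ _)

/-- The concatenation `τ|τ'` of permutations: `(τ|τ')(x|y) = τ(x)|τ'(y)`. -/
def concatPerm {r r' : ℕ} (τ : Equiv.Perm (V r)) (τ' : Equiv.Perm (V r')) :
    Equiv.Perm (V (r + r')) :=
  (splitEquiv r r').trans ((τ.prodCongr τ').trans (splitEquiv r r').symm)


/-- A permutation maps blocks to blocks. -/
def MapsBlocks {r : ℕ} (τ : Equiv.Perm (V r)) (π : Equiv.Perm (Pt r)) : Prop :=
  ∀ q ∈ SQS τ, q.image π ∈ SQS τ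

theorem vadd_self {r : ℕ} (a : V r) : a + a = 0 := ZModModule.add_self a

theorem vadd_eq_zero {r : ℕ} {a b : V r} : a + b = 0 ↔ a = b := by
  rw [← ZModModule.sub_eq_add, sub_eq_zero]

theorem MapsBlocks.qAct_eq {r : ℕ} {τ : Equiv.Perm (V r)} {π : Equiv.Perm (Pt r)}
    (h : MapsBlocks τ π) : qAct π (SQS τ) = SQS τ := by
  have hs : (SQS τ).Finite := Set.toFinite _
  apply Set.eq_of_subset_of_ncard_le _ _ hs
  · rintro _ ⟨q, hq, rfl⟩
    exact h q hq
  · unfold qAct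
    rw [Set.ncard_image_of_injective _ (Finset.image_injective π.injective)]

theorem MapsBlocks.of_qAct {r : ℕ} {τ : Equiv.Perm (V r)} {π : Equiv.Perm (Pt r)}
    (h : qAct π (SQS τ) = SQS τ) : MapsBlocks τ π := by
  intro q hq
  rw [← h]
  exact ⟨q, hq, rfl⟩

theorem MapsBlocks.trans {r : ℕ} {τ : Equiv.Perm (V r)} {π ρ : Equiv.Perm (Pt r)}
    (h : MapsBlocks τ π) (h' : MapsBlocks τ ρ) : MapsBlocks τ (π.trans ρ) := by
  intro q hq
  have := h' _ (h q hq)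
  rw [Finset.image_image] at this
  exact this

theorem MapsBlocks.symm {r : ℕ} {τ : Equiv.Perm (V r)} {π : Equiv.Perm (Pt r)}
    (h : MapsBlocks τ π) : MapsBlocks τ π.symm := by
  intro q hq
  rw [← h.qAct_eq] at hq
  obtain ⟨q', hq', rfl⟩ := hq
  simpa [Finset.image_image] using hq'

/-- Translations of both halves. -/
def tr {r : ℕ} (u v : V r) : Equiv.Perm (Pt r) :=
  Equiv.sumCongr (Equiv.addRight u) (Equiv.addRight v)

@[simp] theorem tr_inl {r : ℕ} (u v a : V r) : tr u v (Sum.inl a) = Sum.inl (a + u) := rfl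
@[simp] theorem tr_inr {r : ℕ} (u v a : V r) : tr u v (Sum.inr a) = Sum.inr (a + v) := rfl

theorem four_tr {r : ℕ} {a b c d : V r} (u : V r) (h : a + b + c + d = 0) :
    (a + u) + (b + u) + (c + u) + (d + u) = 0 := by
  have : (a + u) + (b + u) + (c + u) + (d + u) = (a + b + c + d) + ((u + u) + (u + u)) := by abel
  rw [this, h, vadd_self]; simp

theorem two_tr {r : ℕ} (a b u : V r) : (a + u) + (b + u) = a + b := by
  have : (a + u) + (b + u) = (a + b) + (u + u) := by abel
  rw [this, vadd_self, add_zero]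

theorem tr_maps {r : ℕ} (τ : Equiv.Perm (V r)) (u v : V r) : MapsBlocks τ (tr u v) := by
  rintro q ((⟨a, b, c, d, h1, h2, h3, h4, h5, h6, hs, rfl⟩ |
    ⟨a, b, c, d, h1, h2, h3, h4, h5, h6, hs, rfl⟩) | ⟨a, b, c, d, h1, h2, rfl⟩)
  · refine Or.inl (Or.inl ⟨a + u, b + u, c + u, d + u, ?_, ?_, ?_, ?_, ?_, ?_,
      four_tr u hs, by simp [Finset.image_insert]⟩) <;> simpa
  · refine Or.inl (Or.inr ⟨a + v, b + v, c + v, d + v, ?_, ?_, ?_, ?_, ?_, ?_,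
      four_tr v hs, by simp [Finset.image_insert]⟩) <;> simpa
  · refine Or.inr ⟨a + u, b + v, c + u, d + v, ?_, ?_, by simp [Finset.image_insert]⟩
    · rw [two_tr, two_tr, h1]
    · rwa [two_tr]

/-- Map exchanging the halves. -/
def sw {r : ℕ} (A B : Equiv.Perm (V r)) : Equiv.Perm (Pt r) :=
  (Equiv.sumCongr A B).trans (Equiv.sumComm _ _)

@[simp] theorem sw_inl {r : ℕ} (A B : Equiv.Perm (V r)) (a : V r) :
    sw A B (Sum.inl a) = Sum.inr (A a) := rfl
@[simp] theorem sw_inr {r : ℕ} (A B : Equiv.Perm (V r)) (a : V r) :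
    sw A B (Sum.inr a) = Sum.inl (B a) := rfl

/-- The algebraic criterion: `τ B τ = A` for additive bijections `A`, `B`. -/
def Crit {r : ℕ} (τ : Equiv.Perm (V r)) : Prop :=
  ∃ A B : Equiv.Perm (V r), (∀ x y, A (x + y) = A x + A y) ∧ (∀ x y, B (x + y) = B x + B y) ∧
    ∀ x, τ (B (τ x)) = A x

theorem add_zero_map {r : ℕ} {A : V r → V r} (h : ∀ x y, A (x + y) = A x + A y) : A 0 = 0 := by
  simpa using h 0 0

theorem sw_maps {r : ℕ} {τ A B : Equiv.Perm (V r)}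
    (hA : ∀ x y, A (x + y) = A x + A y) (hB : ∀ x y, B (x + y) = B x + B y)
    (h : ∀ x, τ (B (τ x)) = A x) (h0 : τ 0 = 0) : MapsBlocks τ (sw A B) := by
  have hA0 := add_zero_map hA
  have hB0 := add_zero_map hB
  rintro q ((⟨a, b, c, d, h1, h2, h3, h4, h5, h6, hs, rfl⟩ |
    ⟨a, b, c, d, h1, h2, h3, h4, h5, h6, hs, rfl⟩) | ⟨a, b, c, d, h1, h2, rfl⟩)
  · refine Or.inl (Or.inr ⟨A a, A b, A c, A d, ?_, ?_, ?_, ?_, ?_, ?_,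
      by rw [← hA, ← hA, ← hA, hs, hA0], by simp [Finset.image_insert]⟩) <;> simpa
  · refine Or.inl (Or.inl ⟨B a, B b, B c, B d, ?_, ?_, ?_, ?_, ?_, ?_,
      by rw [← hB, ← hB, ← hB, hs, hB0], by simp [Finset.image_insert]⟩) <;> simpa
  · refine Or.inr ⟨B b, A a, B d, A c, ?_, ?_, ?_⟩
    · rw [← hB, ← hA, ← h1, h]
    · rw [← hA, ← hA0, A.injective.ne_iff]
      intro hac
      rw [hac, h0] at h1
      exact h2 h1.symm
    · ext x
      simp [Finset.image_insert]
      tauto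

theorem Crit.trans {r : ℕ} {τ : Equiv.Perm (V r)} (h0 : τ 0 = 0) (hc : Crit τ) :
    SQSPointTransitive τ := by
  obtain ⟨A, B, hA, hB, h⟩ := hc
  have hs := sw_maps hA hB h h0
  have key : ∀ p p', ∃ π : Equiv.Perm (Pt r), MapsBlocks τ π ∧ π p = p' := by
    rintro (a | a) (b | b)
    · exact ⟨tr (b - a) 0, tr_maps _ _ _, by simp⟩
    · exact ⟨(sw A B).trans (tr 0 (b - A a)), hs.trans (tr_maps _ _ _), by simp⟩
    · exact ⟨(sw A B).trans (tr (b - B a) 0), hs.trans (tr_maps _ _ _), by simp⟩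
    · exact ⟨tr 0 (b - a), tr_maps _ _ _, by simp⟩
  intro p p'
  obtain ⟨π, h1, h2⟩ := key p p'
  exact ⟨π, h1.qAct_eq, h2⟩

/-- Half indicator. -/
def side {r : ℕ} : Pt r → ZMod 2 := Sum.elim (fun _ => 0) (fun _ => 1)
/-- Left part. -/
def lpart {r : ℕ} : Pt r → V r := Sum.elim id (fun _ => 0)
/-- Right part. -/
def rpart {r : ℕ} : Pt r → V r := Sum.elim (fun _ => 0) id

theorem sum_four {α M : Type} [DecidableEq α] [AddCommMonoid M] (f : α → M) {a b c d : α}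
    (h1 : a ≠ b) (h2 : a ≠ c) (h3 : a ≠ d) (h4 : b ≠ c) (h5 : b ≠ d) (h6 : c ≠ d) :
    ∑ p ∈ ({a, b, c, d} : Finset α), f p = f a + f b + f c + f d := by
  rw [Finset.sum_insert (by simp [*]), Finset.sum_insert (by simp [*]),
    Finset.sum_insert (by simp [*]), Finset.sum_singleton]
  abel

theorem block_inv {r : ℕ} {τ : Equiv.Perm (V r)} (h0 : τ 0 = 0) {q : Finset (Pt r)}
    (hq : q ∈ SQS τ) :
    ∑ p ∈ q, side p = 0 ∧ τ (∑ p ∈ q, lpart p) = ∑ p ∈ q, rpart p := by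
  have e2 : (1 + 1 : ZMod 2) = 0 := by decide
  have e4 : (1 + 1 + 1 + 1 : ZMod 2) = 0 := by decide
  obtain ((⟨a, b, c, d, h1, h2, h3, h4, h5, h6, hs, rfl⟩ |
    ⟨a, b, c, d, h1, h2, h3, h4, h5, h6, hs, rfl⟩) | ⟨a, b, c, d, h1, h2, rfl⟩) := hq
  · repeat rw [sum_four _ (by simpa) (by simpa) (by simpa) (by simpa) (by simpa) (by simpa)]
    simp [side, lpart, rpart, hs, h0]
  · repeat rw [sum_four _ (by simpa) (by simpa) (by simpa) (by simpa) (by simpa) (by simpa)]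
    simp [side, lpart, rpart, hs, h0, e4]
  · have hac : a ≠ c := by
      rintro rfl
      rw [vadd_self, h0] at h1
      exact h2 h1.symm
    have hbd : b ≠ d := fun h => h2 (vadd_eq_zero.2 h)
    repeat rw [sum_four _ (by simpa) (by simp) (by simp) (by simp) (by simp) (by simpa)]
    simp [side, lpart, rpart, h1, e2]

theorem mk_quad {r : ℕ} {a b c : V r} (h1 : a ≠ b) (h2 : a ≠ c) (h3 : b ≠ c) :
    a ≠ a + b + c ∧ b ≠ a + b + c ∧ c ≠ a + b + c ∧ a + b + c + (a + b + c) = 0 := by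
  refine ⟨fun h => h3 ?_, fun h => h2 ?_, fun h => h1 ?_, vadd_self _⟩
  · rw [add_assoc, left_eq_add] at h
    exact vadd_eq_zero.1 h
  · rw [add_right_comm, right_eq_add] at h
    exact vadd_eq_zero.1 h
  · rw [right_eq_add] at h
    exact vadd_eq_zero.1 h

theorem block_l {r : ℕ} (τ : Equiv.Perm (V r)) {M : Type} [AddCommMonoid M]
    {a b c : V r} (h1 : a ≠ b) (h2 : a ≠ c) (h3 : b ≠ c) :
    ∃ q ∈ SQS τ, ∀ f : Pt r → M, ∑ p ∈ q, f p =
      f (.inl a) + f (.inl b) + f (.inl c) + f (.inl (a + b + c)) := by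
  obtain ⟨h4, h5, h6, hs⟩ := mk_quad h1 h2 h3
  refine ⟨_, Or.inl (Or.inl ⟨a, b, c, a + b + c, h1, h2, h4, h3, h5, h6, hs, rfl⟩), fun f => ?_⟩
  exact sum_four _ (Sum.inl_injective.ne h1) (Sum.inl_injective.ne h2) (Sum.inl_injective.ne h4) (Sum.inl_injective.ne h3)
    (Sum.inl_injective.ne h5) (Sum.inl_injective.ne h6)

theorem block_r {r : ℕ} (τ : Equiv.Perm (V r)) {M : Type} [AddCommMonoid M]
    {a b c : V r} (h1 : a ≠ b) (h2 : a ≠ c) (h3 : b ≠ c) :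
    ∃ q ∈ SQS τ, ∀ f : Pt r → M, ∑ p ∈ q, f p =
      f (.inr a) + f (.inr b) + f (.inr c) + f (.inr (a + b + c)) := by
  obtain ⟨h4, h5, h6, hs⟩ := mk_quad h1 h2 h3
  refine ⟨_, Or.inl (Or.inr ⟨a, b, c, a + b + c, h1, h2, h4, h3, h5, h6, hs, rfl⟩), fun f => ?_⟩
  exact sum_four _ (Sum.inr_injective.ne h1) (Sum.inr_injective.ne h2) (Sum.inr_injective.ne h4) (Sum.inr_injective.ne h3)
    (Sum.inr_injective.ne h5) (Sum.inr_injective.ne h6)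

theorem block_t {r : ℕ} {τ : Equiv.Perm (V r)} (h0 : τ 0 = 0) {M : Type} [AddCommMonoid M]
    {x : V r} (hx : x ≠ 0) (a b : V r) :
    ∃ q ∈ SQS τ, ∀ f : Pt r → M, ∑ p ∈ q, f p =
      f (.inl a) + f (.inl (a + x)) + f (.inr b) + f (.inr (b + τ x)) := by
  have hx' : τ x ≠ 0 := by rwa [← h0, τ.injective.ne_iff]
  have e : ∀ y : V r, ∀ z, y + (y + z) = z := fun y z => by rw [← add_assoc, vadd_self, zero_add]
  refine ⟨_, Or.inr ⟨a, b, a + x, b + τ x, ?_, ?_, rfl⟩, fun f => ?_⟩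
  · rw [e, e]
  · rwa [e]
  · exact sum_four _ (by simpa) (by simp) (by simp) (by simp) (by simp) (by simpa)

theorem maps_inv {r : ℕ} {τ : Equiv.Perm (V r)} (h0 : τ 0 = 0) {π : Equiv.Perm (Pt r)}
    (hπ : MapsBlocks τ π) {q : Finset (Pt r)} (hq : q ∈ SQS τ) :
    ∑ p ∈ q, side (π p) = 0 ∧ τ (∑ p ∈ q, lpart (π p)) = ∑ p ∈ q, rpart (π p) := by
  have := block_inv h0 (hπ q hq)
  simpa only [Finset.sum_image π.injective.injOn] using this

theorem zmod2_ne {a b : ZMod 2} : a ≠ b ↔ a = b + 1 := by revert a b; decide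

/-- Some automorphism exchanges the halves. -/
theorem exists_flip {r : ℕ} {τ : Equiv.Perm (V r)} (h0 : τ 0 = 0)
    (ht : SQSPointTransitive τ) :
    ∃ ρ : Equiv.Perm (Pt r), MapsBlocks τ ρ ∧ ∀ p, side (ρ p) = side p + 1 := by
  obtain ⟨π, hπ, hp⟩ := ht (.inl 0) (.inr 0)
  replace hπ := MapsBlocks.of_qAct hπ
  by_cases hc : ∀ u, side (π (.inl u)) = side (π (.inl 0))
  · have hl : ∀ u, side (π (.inl u)) = 1 := fun u => by rw [hc, hp]; rfl
    choose A hA using fun u => (show ∃ w, π (.inl u) = .inr w by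
      have := hl u
      rcases h : π (.inl u) with w | w
      · rw [h] at this; simp [side] at this
      · exact ⟨w, rfl⟩)
    have hAi : Function.Injective A := by
      intro x y hxy
      have : π (.inl x) = π (.inl y) := by rw [hA, hA, hxy]
      simpa using this
    have hAs := Finite.surjective_of_injective hAi
    refine ⟨π, hπ, ?_⟩
    rintro (u | u)
    · rw [hl]; simp [side]
    · rcases h : π (.inr u) with w | w
      · simp [side]; decide
      · obtain ⟨x, rfl⟩ := hAs w
        rw [← hA] at h
        simpa using h
  · push Not at hc
    obtain ⟨u, hu⟩ := hc
    have hu0 : u ≠ 0 := by rintro rfl; exact hu rfl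
    rw [zmod2_ne] at hu
    have e : ∀ a b c d : ZMod 2, a + b + c + d = 0 → b = a + 1 → d = c + 1 := by decide
    have hflip : ∀ p, side (π (tr u (τ u) p)) = side (π p) + 1 := by
      rintro (a | a)
      · by_cases ha : a = 0
        · subst ha; simpa using hu
        by_cases hau : a = u
        · subst hau
          rw [tr_inl, vadd_self, hu, add_assoc]
          have : (1 + 1 : ZMod 2) = 0 := by decide
          rw [this, add_zero]
        obtain ⟨q, hq, hs⟩ := block_l τ (M := ZMod 2) hu0.symm (Ne.symm ha) (Ne.symm hau)
        have := (maps_inv h0 hπ hq).1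
        rw [hs (fun p => side (π p)), zero_add, add_comm u a] at this
        exact e _ _ _ _ this hu
      · obtain ⟨q, hq, hs⟩ := block_t h0 (M := ZMod 2) hu0 0 a
        have := (maps_inv h0 hπ hq).1
        rw [hs (fun p => side (π p)), zero_add] at this
        exact e _ _ _ _ this hu
    refine ⟨π.symm.trans ((tr u (τ u)).trans π), hπ.symm.trans ((tr_maps _ _ _).trans hπ), ?_⟩
    intro p
    simpa using hflip (π.symm p)

theorem crit_of_trans {r : ℕ} {τ : Equiv.Perm (V r)} (h0 : τ 0 = 0)
    (ht : SQSPointTransitive τ) : Crit τ := by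
  obtain ⟨ρ, hρ, hf⟩ := exists_flip h0 ht
  have hl : ∀ u, ∃ w, ρ (.inl u) = .inr w := by
    intro u
    have := hf (.inl u)
    rcases h : ρ (.inl u) with w | w
    · rw [h] at this; simp [side] at this
    · exact ⟨w, rfl⟩
  have hr : ∀ u, ∃ w, ρ (.inr u) = .inl w := by
    intro u
    have := hf (.inr u)
    rcases h : ρ (.inr u) with w | w
    · exact ⟨w, rfl⟩
    · rw [h] at this; simp [side] at this
  obtain ⟨a0, ha0⟩ := hl 0
  obtain ⟨b0, hb0⟩ := hr 0
  choose A hA using fun u => (show ∃ w, (ρ.trans (tr b0 a0)) (.inl u) = .inr w by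
    obtain ⟨w, hw⟩ := hl u
    exact ⟨w + a0, by simp [hw]⟩)
  choose B hB using fun u => (show ∃ w, (ρ.trans (tr b0 a0)) (.inr u) = .inl w by
    obtain ⟨w, hw⟩ := hr u
    exact ⟨w + b0, by simp [hw]⟩)
  have hA0 : A 0 = 0 := by
    have := hA 0
    simp [ha0, vadd_self] at this
    exact this.symm
  have hB0 : B 0 = 0 := by
    have := hB 0
    simp [hb0, vadd_self] at this
    exact this.symm
  have hm : MapsBlocks τ (ρ.trans (tr b0 a0)) := hρ.trans (tr_maps _ _ _)
  generalize ρ.trans (tr b0 a0) = π at hA hB hm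
  have hAi : Function.Injective A := by
    intro x y hxy
    have : π (.inl x) = π (.inl y) := by rw [hA, hA, hxy]
    simpa using this
  have hBi : Function.Injective B := by
    intro x y hxy
    have : π (.inr x) = π (.inr y) := by rw [hB, hB, hxy]
    simpa using this
  have hAadd : ∀ x y, A (x + y) = A x + A y := by
    intro x y
    by_cases hx : x = 0
    · subst hx; simp [hA0]
    by_cases hy : y = 0
    · subst hy; simp [hA0]
    by_cases hxy : x = y
    · subst hxy; rw [vadd_self, vadd_self, hA0]
    obtain ⟨q, hq, hs⟩ := block_l τ (M := V r) (Ne.symm hx) (Ne.symm hy) hxy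
    have := (maps_inv h0 hm hq).2
    rw [hs (fun p => lpart (π p)), hs (fun p => rpart (π p))] at this
    simp only [hA, lpart, rpart, Sum.elim_inr, zero_add, h0, hA0, id, add_zero] at this
    exact (vadd_eq_zero.1 this.symm).symm
  have hBadd : ∀ x y, B (x + y) = B x + B y := by
    intro x y
    by_cases hx : x = 0
    · subst hx; simp [hB0]
    by_cases hy : y = 0
    · subst hy; simp [hB0]
    by_cases hxy : x = y
    · subst hxy; rw [vadd_self, vadd_self, hB0]
    obtain ⟨q, hq, hs⟩ := block_r τ (M := V r) (Ne.symm hx) (Ne.symm hy) hxy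
    have := (maps_inv h0 hm hq).2
    rw [hs (fun p => lpart (π p)), hs (fun p => rpart (π p))] at this
    simp only [hB, lpart, rpart, Sum.elim_inl, zero_add, hB0, id, add_zero] at this
    rw [← h0, τ.injective.eq_iff] at this
    exact (vadd_eq_zero.1 this).symm
  refine ⟨Equiv.ofBijective A (Finite.injective_iff_bijective.1 hAi),
    Equiv.ofBijective B (Finite.injective_iff_bijective.1 hBi), hAadd, hBadd, fun x => ?_⟩
  change τ (B (τ x)) = A x
  by_cases hx : x = 0
  · subst hx; rw [h0, hB0, h0, hA0]
  obtain ⟨q, hq, hs⟩ := block_t h0 (M := V r) hx 0 0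
  have := (maps_inv h0 hm hq).2
  rw [hs (fun p => lpart (π p)), hs (fun p => rpart (π p))] at this
  simpa [hA, hB, lpart, rpart, hA0, hB0] using this

theorem split_add {r r' : ℕ} (x y : V (r + r')) :
    splitEquiv r r' (x + y) = splitEquiv r r' x + splitEquiv r r' y := rfl

theorem concat_add {r r' : ℕ} {A : Equiv.Perm (V r)} {A' : Equiv.Perm (V r')}
    (h : ∀ x y, A (x + y) = A x + A y) (h' : ∀ x y, A' (x + y) = A' x + A' y)
    (x y : V (r + r')) :
    concatPerm A A' (x + y) = concatPerm A A' x + concatPerm A A' y := by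
  apply (splitEquiv r r').injective
  rw [split_add]
  ext1 <;> simp [concatPerm, split_add, h, h', Prod.map]

theorem concat_zero {r r' : ℕ} {τ : Equiv.Perm (V r)} {τ' : Equiv.Perm (V r')}
    (h0 : τ 0 = 0) (h0' : τ' 0 = 0) : concatPerm τ τ' 0 = 0 := by
  apply (splitEquiv r r').injective
  have : splitEquiv r r' 0 = 0 := rfl
  ext1 <;> simp [concatPerm, this, h0, h0', Prod.map]

theorem Crit.concat {r r' : ℕ} {τ : Equiv.Perm (V r)} {τ' : Equiv.Perm (V r')}
    (h : Crit τ) (h' : Crit τ') : Crit (concatPerm τ τ') := by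
  obtain ⟨A, B, hA, hB, h⟩ := h
  obtain ⟨A', B', hA', hB', h'⟩ := h'
  refine ⟨concatPerm A A', concatPerm B B', concat_add hA hA', concat_add hB hB', fun x => ?_⟩
  simp [concatPerm, h, h', Prod.map]

/-- if `SQS_τ` and `SQS_{τ'}` are point transitive Steiner quadruple
systems, then so is `SQS_{τ|τ'}`. -/
theorem SQS_concat_pointTransitive {r r' : ℕ}
    (τ : Equiv.Perm (V r)) (τ' : Equiv.Perm (V r'))
    (h0 : τ 0 = 0) (h0' : τ' 0 = 0)
    (ht : SQSPointTransitive τ) (ht' : SQSPointTransitive τ') :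
    SQSPointTransitive (concatPerm τ τ') :=
  Crit.trans (concat_zero h0 h0') ((crit_of_trans h0 ht).concat (crit_of_trans h0' ht'))
end

section
/- For every integer r ≥ 3 with r ≠ 5, there exists a neighbor transitive extended perfect binary code of length 2^{r+1} that is non-Mollard, i.e., not isomorphic to any Mollard code M(C,D) built from extended perfect codes C, D with an arbitrary function φ. -/
open Finset

namespace NTNM

set_option linter.unusedSectionVars false
set_option linter.unusedSimpArgs false

/-- The algebraic conditions on a permutation `τ` of an elementary abelian 2-group. -/
structure Good {V : Type} [AddCommGroup V] (τ : Equiv.Perm V) : Prop where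
  zero : τ 0 = 0
  inv : ∀ x, τ (τ x) = x
  tr : ∀ a, ∃ A B : V ≃+ V, ∀ b, τ (a + A b) = τ a + B (τ b)
  nk : ∀ x, (∀ u, τ (u + x) = τ u + τ x) → x = 0

def HasGood (r : ℕ) : Prop :=
  ∃ (V : Type) (_ : AddCommGroup V) (_ : Module (ZMod 2) V) (_ : Fintype V) (τ : Equiv.Perm V),
    Fintype.card V = 2 ^ r ∧ Good τ

theorem HasGood.add {r s : ℕ} (h1 : HasGood r) (h2 : HasGood s) : HasGood (r + s) := by
  obtain ⟨V, _, _, _, τ, hc, h⟩ := h1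
  obtain ⟨W, _, _, _, σ, hd, k⟩ := h2
  refine ⟨V × W, inferInstance, inferInstance, inferInstance, τ.prodCongr σ, ?_, ?_, ?_, ?_, ?_⟩
  · rw [Fintype.card_prod, hc, hd, pow_add]
  · ext <;> simp [h.zero, k.zero]
  · intro x
    ext <;> simp [h.inv, k.inv]
  · intro a
    obtain ⟨A, B, hAB⟩ := h.tr a.1
    obtain ⟨A', B', hAB'⟩ := k.tr a.2
    refine ⟨A.prodCongr A', B.prodCongr B', fun b => ?_⟩
    ext
    · exact hAB b.1
    · exact hAB' b.2
  · intro x hx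
    ext
    · exact h.nk x.1 fun u => by simpa using congrArg Prod.fst (hx (u, 0))
    · exact k.nk x.2 fun u => by simpa using congrArg Prod.snd (hx (0, u))

/-- Build an additive automorphism of a finite group from an additive injective function. -/
theorem exists_addEquiv {V : Type} [AddCommGroup V] [Finite V] (f : V → V)
    (hf : ∀ x y, f (x + y) = f x + f y) (hi : ∀ x, f x = 0 → x = 0) :
    ∃ A : V ≃+ V, ∀ x, A x = f x := by
  let F : V →+ V := AddMonoidHom.mk' f hf
  have hF : Function.Injective F := (injective_iff_map_eq_zero F).2 hi
  exact ⟨AddEquiv.ofBijective F (Finite.injective_iff_bijective.1 hF), fun x => rfl⟩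

theorem good_of {V : Type} [AddCommGroup V] [Finite V] (t : V → V) (L : V → V → V)
    (h0 : t 0 = 0) (hinv : ∀ x, t (t x) = x)
    (hL : ∀ a x y, L a (x + y) = L a x + L a y) (hLi : ∀ a x, L a x = 0 → x = 0)
    (ht : ∀ a b, t (a + L a b) = t a + L (t a) (t b))
    (hn : ∀ x, (∀ u, t (u + x) = t u + t x) → x = 0) :
    ∃ τ : Equiv.Perm V, Good τ := by
  refine ⟨⟨t, t, hinv, hinv⟩, h0, hinv, fun a => ?_, hn⟩
  obtain ⟨A, hA⟩ := exists_addEquiv (L a) (hL a) (hLi a)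
  obtain ⟨B, hB⟩ := exists_addEquiv (L (t a)) (hL _) (hLi _)
  exact ⟨A, B, fun b => by simpa [hA, hB] using ht a b⟩

abbrev F2 := ZMod 2

def t3 : F2 × F2 × F2 → F2 × F2 × F2 := fun (x, y, z) => (x, x * y + z, y + x * y + x * z)

def L3 : F2 × F2 × F2 → F2 × F2 × F2 → F2 × F2 × F2 :=
  fun (a, b, _) (x, y, z) => (x, y + x * a, z + x * a + y * a + x * b)

theorem hasGood_three : HasGood 3 := by
  obtain ⟨τ, h⟩ := good_of t3 L3 (by decide) (by decide)
    (by rintro ⟨a, b, c⟩ ⟨x, y, z⟩ ⟨x', y', z'⟩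
        simp only [L3, Prod.mk_add_mk, Prod.mk.injEq, add_mul]
        refine ⟨?_, ?_, ?_⟩ <;> first | trivial | abel) (by decide +kernel) (by decide +kernel) (by decide +kernel)
  exact ⟨F2 × F2 × F2, inferInstance, inferInstance, inferInstance, τ, by decide +kernel, h⟩

def t4 : F2 × F2 × F2 × F2 → F2 × F2 × F2 × F2 :=
  fun (x, y, z, w) => (z, x * y + w, x, y + x * y * z + z * w)

def L4 : F2 × F2 × F2 × F2 → F2 × F2 × F2 × F2 → F2 × F2 × F2 × F2 :=
  fun (a, b, c, _) (x, y, z, w) =>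
    (x, y + x * a + x * c, z, w + y * a + z * a + x * b + x * c + z * c + x * a * c)

theorem hasGood_four : HasGood 4 := by
  obtain ⟨τ, h⟩ := good_of t4 L4 (by decide) (by decide +kernel)
    (by rintro ⟨a, b, c, d⟩ ⟨x, y, z, w⟩ ⟨x', y', z', w'⟩
        simp only [L4, Prod.mk_add_mk, Prod.mk.injEq, add_mul]
        refine ⟨?_, ?_, ?_, ?_⟩ <;> first | trivial | abel)
      (by decide +kernel) (by decide +kernel) (by decide +kernel)
  exact ⟨F2 × F2 × F2 × F2, inferInstance, inferInstance, inferInstance, τ, by decide +kernel, h⟩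

theorem hasGood (r : ℕ) (hr : 3 ≤ r) (hr5 : r ≠ 5) : HasGood r := by
  induction r using Nat.strong_induction_on with
  | _ r ih =>
    by_cases h3 : r = 3
    · subst h3; exact hasGood_three
    by_cases h4 : r = 4
    · subst h4; exact hasGood_four
    by_cases h8 : r = 8
    · subst h8; exact hasGood_four.add hasGood_four
    have := (ih (r - 3) (by omega) (by omega) (by omega)).add hasGood_three
    rwa [Nat.sub_add_cancel hr] at this

section code

variable {V : Type} [AddCommGroup V] [Module (ZMod 2) V] [Fintype V]

/-- parity of a word -/
def par (y : V → ZMod 2) : ZMod 2 := ∑ a, y a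

/-- syndrome of a word -/
def syn (y : V → ZMod 2) : V := ∑ a, y a • a

theorem par_add (x y : V → ZMod 2) : par (x + y) = par x + par y := by
  simp [par, Finset.sum_add_distrib]

theorem syn_add (x y : V → ZMod 2) : syn (x + y) = syn x + syn y := by
  simp [syn, Finset.sum_add_distrib, add_smul]

theorem par_zero : par (0 : V → ZMod 2) = 0 := by simp [par]

theorem syn_zero : syn (0 : V → ZMod 2) = 0 := by simp [syn]

theorem par_single [DecidableEq V] (a : V) (c : ZMod 2) : par (Pi.single a c) = c := by
  simp [par]

theorem syn_single [DecidableEq V] (a : V) (c : ZMod 2) : syn (Pi.single a c) = c • a := by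
  rw [syn, Finset.sum_eq_single a] <;> simp +contextual [Pi.single_apply]

theorem vadd_self (x : V) : x + x = 0 := by
  have : (2 : ZMod 2) • x = 0 := by
    rw [show (2 : ZMod 2) = 0 from rfl, zero_smul]
  rwa [two_smul] at this

theorem veq_of_add {x y : V} (h : x + y = 0) : x = y := by
  have := vadd_self y
  exact add_right_cancel (h.trans this.symm)

theorem zne {x : ZMod 2} : x ≠ 0 ↔ x = 1 := by revert x; decide

/-- The weight as an element of `ZMod 2`. -/
theorem par_eq_norm (y : V → ZMod 2) : par y = (hammingNorm y : ZMod 2) := by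
  rw [hammingNorm, Finset.card_filter, par]
  push_cast
  refine Finset.sum_congr rfl fun a _ => ?_
  generalize y a = c
  revert c; decide

theorem norm_even {y : V → ZMod 2} (h : par y = 0) : Even (hammingNorm y) := by
  rw [par_eq_norm] at h
  exact (ZMod.natCast_eq_zero_iff_even).1 h

theorem norm_ge_two {y : V → ZMod 2} (h : par y = 0) (hy : y ≠ 0) : 2 ≤ hammingNorm y := by
  obtain ⟨k, hk⟩ := norm_even h
  have := hammingNorm_pos_iff.2 hy
  omega

theorem norm_ge_four {y : V → ZMod 2} (h : par y = 0) (hs : syn y = 0) (hy : y ≠ 0) :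
    4 ≤ hammingNorm y := by
  classical
  obtain ⟨k, hk⟩ := norm_even h
  have h2 := norm_ge_two h hy
  by_contra hlt
  have h2 : hammingNorm y = 2 := by omega
  rw [hammingNorm, Finset.card_eq_two] at h2
  obtain ⟨a, b, hab, hS⟩ := h2
  apply hab
  apply veq_of_add
  rw [← hs, syn, ← Finset.sum_filter_of_ne (p := fun i => y i ≠ 0), hS, Finset.sum_pair hab]
  · have ha : a ∈ ({a, b} : Finset V) := by simp
    have hb : b ∈ ({a, b} : Finset V) := by simp
    rw [← hS] at ha hb
    rw [zne.1 (Finset.mem_filter.1 ha).2, zne.1 (Finset.mem_filter.1 hb).2, one_smul, one_smul]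
  · intro i _ hi h0
    exact hi (by rw [h0, zero_smul])

/-- left and right halves -/
def lft (z : V ⊕ V → ZMod 2) : V → ZMod 2 := fun a => z (Sum.inl a)
def rgt (z : V ⊕ V → ZMod 2) : V → ZMod 2 := fun a => z (Sum.inr a)

theorem lft_add (x y : V ⊕ V → ZMod 2) : lft (x + y) = lft x + lft y := rfl
theorem rgt_add (x y : V ⊕ V → ZMod 2) : rgt (x + y) = rgt x + rgt y := rfl

theorem norm_split (z : V ⊕ V → ZMod 2) :
    hammingNorm z = hammingNorm (lft z) + hammingNorm (rgt z) := by
  unfold hammingNorm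
  rw [Finset.card_filter, Finset.card_filter, Finset.card_filter, Fintype.sum_sum_type]
  rfl

theorem zself {ι : Type} (x : ι → ZMod 2) : x + x = 0 := by
  funext i
  exact CharTwo.add_self_eq_zero (x i)

theorem dist_eq_norm {ι : Type} [Fintype ι] (x y : ι → ZMod 2) :
    hammingDist x y = hammingNorm (x + y) := by
  rw [hammingDist_eq_hammingNorm]
  congr 1
  funext i
  change -(x i) + y i = x i + y i
  rw [CharTwo.neg_eq]

/-- The code. -/
def SC (τ : Equiv.Perm V) : Set (V ⊕ V → ZMod 2) :=
  {z | par (lft z) = 0 ∧ par (rgt z) = 0 ∧ syn (rgt z) = τ (syn (lft z))}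

theorem zero_mem {τ : Equiv.Perm V} (h : τ 0 = 0) : (0 : V ⊕ V → ZMod 2) ∈ SC τ := by
  have h1 : lft (0 : V ⊕ V → ZMod 2) = 0 := rfl
  have h2 : rgt (0 : V ⊕ V → ZMod 2) = 0 := rfl
  simp [SC, h1, h2, par_zero, syn_zero, h]

open Classical in
/-- the codeword with left syndrome `x` -/
noncomputable def cw (τ : Equiv.Perm V) (x : V) : V ⊕ V → ZMod 2 :=
  Sum.elim (Pi.single 0 1 + Pi.single x 1) (Pi.single 0 1 + Pi.single (τ x) 1)

theorem lft_cw (τ : Equiv.Perm V) (x : V) : syn (lft (cw τ x)) = x := by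
  classical
  have : lft (cw τ x) = Pi.single 0 1 + Pi.single x 1 := by
    funext i; simp [lft, cw]
  rw [this, syn_add, syn_single, syn_single]; simp

theorem cw_mem (τ : Equiv.Perm V) (x : V) : cw τ x ∈ SC τ := by
  classical
  have h1 : lft (cw τ x) = Pi.single 0 1 + Pi.single x 1 := by
    funext i; simp [lft, cw]
  have h2 : rgt (cw τ x) = Pi.single 0 1 + Pi.single (τ x) 1 := by
    funext i; simp [rgt, cw]
  refine ⟨?_, ?_, ?_⟩
  · rw [h1, par_add, par_single, par_single]; rfl
  · rw [h2, par_add, par_single, par_single]; rfl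
  · rw [lft_cw, h2, syn_add, syn_single, syn_single]; simp

theorem norm_two {x : V} [DecidableEq V] (hx : x ≠ 0) :
    hammingNorm (Pi.single 0 1 + Pi.single x 1 : V → ZMod 2) = 2 := by
  rw [hammingNorm, Finset.card_eq_two]
  refine ⟨0, x, hx.symm, ?_⟩
  ext i
  by_cases h0 : i = 0
  · subst h0; simp [Pi.single_apply, hx.symm]
  · by_cases h1 : i = x
    · subst h1; simp [Pi.single_apply, hx]
    · simp [Pi.single_apply, h0, h1]

theorem minDist (τ : Equiv.Perm V) : ∀ x ∈ SC τ, ∀ y ∈ SC τ, x ≠ y → 4 ≤ hammingDist x y := by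
  rintro x ⟨x1, x2, x3⟩ y ⟨y1, y2, y3⟩ hxy
  rw [dist_eq_norm, norm_split, lft_add, rgt_add]
  have p1 : par (lft x + lft y) = 0 := by rw [par_add, x1, y1, add_zero]
  have p2 : par (rgt x + rgt y) = 0 := by rw [par_add, x2, y2, add_zero]
  by_cases hs : syn (lft x) = syn (lft y)
  · have s1 : syn (lft x + lft y) = 0 := by rw [syn_add, hs, vadd_self]
    have s2 : syn (rgt x + rgt y) = 0 := by rw [syn_add, x3, y3, hs, vadd_self]
    by_cases h1 : lft x + lft y = 0
    · have h2 : rgt x + rgt y ≠ 0 := by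
        intro h2
        apply hxy
        have key : ∀ a b : ZMod 2, a + b = 0 → a = b := by decide
        funext i
        rcases i with i | i
        · exact key _ _ (congrFun h1 i)
        · exact key _ _ (congrFun h2 i)
      have := norm_ge_four p2 s2 h2
      omega
    · have := norm_ge_four p1 s1 h1
      omega
  · have h1 : lft x + lft y ≠ 0 := by
      intro h
      have := congrArg syn h
      rw [syn_add, syn_zero] at this
      exact hs (veq_of_add this)
    have h2 : rgt x + rgt y ≠ 0 := by
      intro h
      have := congrArg syn h
      rw [syn_add, syn_zero, x3, y3] at this
      exact hs (τ.injective (veq_of_add this))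
    have := norm_ge_two p1 h1
    have := norm_ge_two p2 h2
    omega

open Classical in
/-- coset representatives -/
noncomputable def rep (p : V × ZMod 2 × ZMod 2) : V ⊕ V → ZMod 2 :=
  Sum.elim (Pi.single 0 p.2.1) (Pi.single p.1 1 + Pi.single 0 p.2.2)

theorem lft_rep [DecidableEq V] (p : V × ZMod 2 × ZMod 2) :
    lft (rep p) = Pi.single 0 p.2.1 := by
  funext i; simp only [lft, rep, Sum.elim_inl]; congr!

theorem rgt_rep [DecidableEq V] (p : V × ZMod 2 × ZMod 2) :
    rgt (rep p) = Pi.single p.1 1 + Pi.single 0 p.2.2 := by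
  funext i; simp only [rgt, rep, Sum.elim_inr]; congr!

theorem rep_mem (τ : Equiv.Perm V) (z : V ⊕ V → ZMod 2) (p : V × ZMod 2 × ZMod 2) :
    z + rep p ∈ SC τ ↔
      p = (syn (rgt z) + τ (syn (lft z)), par (lft z), par (rgt z) + 1) := by
  classical
  have k1 : ∀ a b : ZMod 2, a + b = 0 ↔ b = a := by decide
  have k2 : ∀ a b : ZMod 2, 1 + b = a ↔ b = a + 1 := by decide
  rcases p with ⟨a, i, j⟩
  simp only [SC, Set.mem_ofPred_eq, lft_add, rgt_add, lft_rep, rgt_rep, par_add, syn_add,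
    par_single, syn_single, smul_zero, add_zero, one_smul, k1, k2, Prod.mk.injEq]
  constructor
  · rintro ⟨h1, h2, h3⟩
    refine ⟨?_, h1, h2⟩
    rw [← h3, ← add_assoc, vadd_self, zero_add]
  · rintro ⟨h1, h2, h3⟩
    refine ⟨h2, h3, ?_⟩
    rw [h1, ← add_assoc, vadd_self, zero_add]

theorem card_SC (τ : Equiv.Perm V) :
    Nat.card (SC τ) * (2 * Fintype.card (V ⊕ V)) = 2 ^ Fintype.card (V ⊕ V) := by
  classical
  let f : SC τ × (V × ZMod 2 × ZMod 2) → (V ⊕ V → ZMod 2) := fun q => q.1.1 + rep q.2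
  have hadd : ∀ a b : V ⊕ V → ZMod 2, a + b + b = a := fun a b => by
    rw [add_assoc, zself, add_zero]
  have hf : Function.Bijective f := by
    constructor
    · rintro ⟨⟨c, hc⟩, p⟩ ⟨⟨d, hd⟩, q⟩ h
      have h' : c + rep p = d + rep q := h
      have e1 : c + rep p + rep p ∈ SC τ := by rwa [hadd]
      have e2 : c + rep p + rep q ∈ SC τ := by rwa [h', hadd]
      rw [rep_mem] at e1 e2
      have hpq : p = q := e1.trans e2.symm
      subst hpq
      have : c = d := add_right_cancel h'
      subst this
      rfl
    · intro z
      refine ⟨⟨⟨z + rep _, (rep_mem τ z _).2 rfl⟩, _⟩, hadd _ _⟩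
  have := Nat.card_congr (Equiv.ofBijective f hf)
  rw [Nat.card_prod] at this
  simp only [Nat.card_eq_fintype_card, Fintype.card_prod, ZMod.card, Fintype.card_fun] at this
  rw [Nat.card_eq_fintype_card, ← this, Fintype.card_sum]
  ring

theorem extPerfect_SC {τ : Equiv.Perm V} (h : τ 0 = 0) (hV : ∃ x : V, x ≠ 0) :
    IsExtPerfect (SC τ) := by
  classical
  refine ⟨minDist τ, ?_, card_SC τ⟩
  obtain ⟨x, hx⟩ := hV
  refine ⟨_, cw_mem τ x, 0, zero_mem h, ?_⟩
  rw [dist_eq_norm, add_zero, norm_split]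
  have h1 : lft (cw τ x) = Pi.single 0 1 + Pi.single x 1 := by
    funext i; simp [lft, cw]
  have h2 : rgt (cw τ x) = Pi.single 0 1 + Pi.single (τ x) 1 := by
    funext i; simp [rgt, cw]
  have h3 : τ x ≠ 0 := fun h' => hx (τ.injective (h'.trans h.symm))
  rw [h1, h2, norm_two hx, norm_two h3]

end code

section aut

variable {ι : Type}

/-- The second word is the image of the first under an automorphism of `C`. -/
def Reach (C : Set (ι → ZMod 2)) (y y' : ι → ZMod 2) : Prop :=
  ∃ (x : ι → ZMod 2) (π : Equiv.Perm ι),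
    (fun w => x + permAct π w) '' C = C ∧ x + permAct π y = y'

theorem permAct_add (π : Equiv.Perm ι) (x y : ι → ZMod 2) :
    permAct π (x + y) = permAct π x + permAct π y := rfl

theorem permAct_mul (π σ : Equiv.Perm ι) (x : ι → ZMod 2) :
    permAct π (permAct σ x) = permAct (π * σ) x := rfl

theorem permAct_inv (π : Equiv.Perm ι) (x : ι → ZMod 2) :
    permAct π⁻¹ (permAct π x) = x := by
  rw [permAct_mul, inv_mul_cancel]; rfl

theorem Reach.trans {C : Set (ι → ZMod 2)} {a b c : ι → ZMod 2}
    (h1 : Reach C a b) (h2 : Reach C b c) : Reach C a c := by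
  obtain ⟨x, π, h, rfl⟩ := h1
  obtain ⟨y, σ, k, rfl⟩ := h2
  have key : ∀ w, (y + permAct σ x) + permAct (σ * π) w = y + permAct σ (x + permAct π w) := by
    intro w
    rw [permAct_add, permAct_mul, add_assoc]
  refine ⟨y + permAct σ x, σ * π, ?_, key a⟩
  simp only [key]
  conv_rhs => rw [← k, ← h]
  rw [Set.image_image]

theorem Reach.symm {C : Set (ι → ZMod 2)} {a b : ι → ZMod 2}
    (h1 : Reach C a b) : Reach C b a := by
  obtain ⟨x, π, h, rfl⟩ := h1
  have key : ∀ w, permAct π⁻¹ x + permAct π⁻¹ (x + permAct π w) = w := by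
    intro w
    rw [permAct_add, permAct_inv, ← add_assoc, zself, zero_add]
  refine ⟨permAct π⁻¹ x, π⁻¹, ?_, key a⟩
  conv_lhs => rw [← h]
  rw [Set.image_image]
  simp [key]

theorem image_eq [Fintype ι] {C : Set (ι → ZMod 2)} (x : ι → ZMod 2) (π : Equiv.Perm ι)
    (h : ∀ w ∈ C, x + permAct π w ∈ C) : (fun w => x + permAct π w) '' C = C := by
  have hinj : Function.Injective (fun w : ι → ZMod 2 => x + permAct π w) := by
    intro a b hab
    have h1 : permAct π a = permAct π b := add_left_cancel hab
    rw [← permAct_inv π a, h1, permAct_inv]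
  apply Set.eq_of_subset_of_ncard_le
  · rintro _ ⟨w, hw, rfl⟩
    exact h w hw
  · rw [Set.ncard_image_of_injective _ hinj]
  · exact Set.toFinite _

theorem permAct_single [DecidableEq ι] (π : Equiv.Perm ι) (i : ι) :
    permAct π (Pi.single i 1 : ι → ZMod 2) = Pi.single (π i) 1 := by
  funext j
  simp only [permAct, Pi.single_apply]
  congr 1
  rw [Equiv.symm_apply_eq]

theorem nbr_form [Fintype ι] [DecidableEq ι] {y c : ι → ZMod 2} (h : hammingDist y c = 1) :
    ∃ i, y = c + Pi.single i 1 := by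
  rw [dist_eq_norm, hammingNorm, Finset.card_eq_one] at h
  obtain ⟨i, hi⟩ := h
  refine ⟨i, ?_⟩
  funext j
  have hj : y j + c j ≠ 0 ↔ j = i := by
    have := Finset.ext_iff.1 hi j
    simpa using this
  have k1 : ∀ a b : ZMod 2, a + b ≠ 0 → a = b + 1 := by decide
  have k2 : ∀ a b : ZMod 2, ¬ (a + b ≠ 0) → a = b + 0 := by decide
  by_cases hji : j = i
  · have := k1 _ _ (hj.2 hji)
    rw [this, hji]; simp
  · have := k2 _ _ (fun h => hji (hj.1 h))
    rw [this]; simp [Pi.single_apply, hji]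

theorem nt_of [Fintype ι] [DecidableEq ι] {C : Set (ι → ZMod 2)} (i₀ : ι)
    (h1 : ∀ c ∈ C, Reach C 0 c)
    (h2 : ∀ i, Reach C (Pi.single i₀ 1) (Pi.single i 1)) : NeighborTransitive C := by
  have key : ∀ y ∈ codeNbrs C, Reach C (Pi.single i₀ 1) y := by
    rintro y ⟨_, c, hc, hd⟩
    obtain ⟨i, rfl⟩ := nbr_form hd
    obtain ⟨x, π, h, hx⟩ := h1 c hc
    have hx : x = c := by
      rw [← hx]; funext j; simp [permAct]
    subst hx
    refine (h2 (π⁻¹ i)).trans ⟨x, π, h, ?_⟩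
    rw [permAct_single]; simp
  exact ⟨fun c hc c' hc' => (h1 c hc).symm.trans (h1 c' hc'),
    fun y hy y' hy' => (key y hy).symm.trans (key y' hy')⟩

variable {V : Type} [AddCommGroup V] [Module (ZMod 2) V] [Fintype V]

/-- affine permutation -/
def aff (a : V) (A : V ≃+ V) : Equiv.Perm V := A.toEquiv.trans (Equiv.addLeft a)

theorem aff_apply (a : V) (A : V ≃+ V) (x : V) : aff a A x = a + A x := rfl

theorem par_perm (π : Equiv.Perm V) (y : V → ZMod 2) : par (permAct π y) = par y :=
  Equiv.sum_comp π.symm y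

theorem syn_aff (a : V) (A : V ≃+ V) (y : V → ZMod 2) (hy : par y = 0) :
    syn (permAct (aff a A) y) = A (syn y) := by
  have h : syn (permAct (aff a A) y) = ∑ j, y j • (aff a A) j := by
    rw [syn, ← Equiv.sum_comp (aff a A)]
    simp [permAct]
  have hA : ∀ (c : ZMod 2) (x : V), A (c • x) = c • A x := fun c x => ZMod.map_smul A c x
  rw [h]
  simp only [aff_apply, smul_add, Finset.sum_add_distrib, ← Finset.sum_smul]
  rw [show (∑ i, y i) = 0 from hy, zero_smul, zero_add, syn, map_sum]
  simp [hA]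

theorem lft_sumCongr (π σ : Equiv.Perm V) (z : V ⊕ V → ZMod 2) :
    lft (permAct (Equiv.sumCongr π σ) z) = permAct π (lft z) := rfl

theorem rgt_sumCongr (π σ : Equiv.Perm V) (z : V ⊕ V → ZMod 2) :
    rgt (permAct (Equiv.sumCongr π σ) z) = permAct σ (rgt z) := rfl

theorem nt_SC {τ : Equiv.Perm V} (h : Good τ) : NeighborTransitive (SC τ) := by
  classical
  have h1 : ∀ c ∈ SC τ, Reach (SC τ) 0 c := by
    rintro c ⟨c1, c2, c3⟩
    obtain ⟨A, B, hAB⟩ := h.tr (syn (lft c))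
    refine ⟨c, Equiv.sumCongr (aff 0 A) (aff 0 B), image_eq _ _ ?_, ?_⟩
    · rintro w ⟨w1, w2, w3⟩
      refine ⟨?_, ?_, ?_⟩
      · rw [lft_add, lft_sumCongr, par_add, par_perm, c1, w1, add_zero]
      · rw [rgt_add, rgt_sumCongr, par_add, par_perm, c2, w2, add_zero]
      · rw [lft_add, rgt_add, lft_sumCongr, rgt_sumCongr, syn_add, syn_add, syn_aff _ _ _ w1,
          syn_aff _ _ _ w2, hAB, c3, w3]
    · funext j; simp [permAct]
  have hl : ∀ a, Reach (SC τ) (Pi.single (Sum.inl 0) 1) (Pi.single (Sum.inl a) 1) := by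
    intro a
    refine ⟨0, Equiv.sumCongr (aff a (AddEquiv.refl V)) (aff a (AddEquiv.refl V)),
      image_eq _ _ ?_, ?_⟩
    · rintro w ⟨w1, w2, w3⟩
      rw [zero_add]
      refine ⟨?_, ?_, ?_⟩
      · rw [lft_sumCongr, par_perm, w1]
      · rw [rgt_sumCongr, par_perm, w2]
      · rw [lft_sumCongr, rgt_sumCongr, syn_aff _ _ _ w1, syn_aff _ _ _ w2]
        exact w3
    · rw [zero_add, permAct_single]; simp [aff_apply]
  refine nt_of (Sum.inl 0) h1 ?_
  rintro (a | a)
  · exact hl a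
  · refine (hl a).trans ⟨0, Equiv.sumComm V V, image_eq _ _ ?_, ?_⟩
    · rintro w ⟨w1, w2, w3⟩
      rw [zero_add]
      refine ⟨w2, w1, ?_⟩
      change syn (lft w) = τ (syn (rgt w))
      rw [w3, h.inv]
    · rw [zero_add, permAct_single]; simp

/-- small words in the kernel of the code miss one of the halves -/
theorem kernel_big {τ : Equiv.Perm V} (h : Good τ) (z : V ⊕ V → ZMod 2)
    (hz : ∀ c ∈ SC τ, z + c ∈ SC τ) (h1 : z (Sum.inl 0) ≠ 0) (h2 : z (Sum.inr 0) ≠ 0) :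
    8 ≤ hammingNorm z := by
  obtain ⟨z1, z2, z3⟩ : z ∈ SC τ := by simpa using hz 0 (zero_mem h.zero)
  have hx : syn (lft z) = 0 := by
    apply h.nk
    intro u
    have c3 := (cw_mem τ u).2.2
    have e3 := (hz _ (cw_mem τ u)).2.2
    rw [lft_add, rgt_add, syn_add, syn_add, c3, lft_cw, z3] at e3
    rw [add_comm u, ← e3, add_comm]
  rw [hx, h.zero] at z3
  have n1 : lft z ≠ 0 := fun h0 => h1 (congrFun h0 0)
  have n2 : rgt z ≠ 0 := fun h0 => h2 (congrFun h0 0)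
  have := norm_ge_four z1 hx n1
  have := norm_ge_four z2 z3 n2
  rw [norm_split]
  omega

end aut

section mollardside

theorem exists_other {t : ℕ} (ht : 4 ≤ t) (i i' : Fin t) :
    ∃ k, k ≠ i ∧ (i' = i ∨ i' = k) := by
  by_cases h : i' = i
  · by_cases h0 : i = ⟨0, by omega⟩
    · exact ⟨⟨1, by omega⟩, by rw [h0]; simp, Or.inl h⟩
    · exact ⟨⟨0, by omega⟩, fun h' => h0 h'.symm, Or.inl h⟩
  · exact ⟨i', h, Or.inr rfl⟩

theorem four_le {t : ℕ} {C : Set (Fin t → ZMod 2)} (h : IsExtPerfect C) : 4 ≤ t := by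
  obtain ⟨-, ⟨x, -, y, -, hxy⟩, -⟩ := h
  have := hammingDist_le_card_fintype (x := x) (y := y)
  simpa [hxy] using this

/-- Any two coordinates of a Mollard code lie in a kernel word of weight at most 4. -/
theorem mollard_kernel {t m : ℕ} (ht : 4 ≤ t) (hm : 4 ≤ m) (C : Set (Fin t → ZMod 2))
    (D : Set (Fin m → ZMod 2)) (φ : (Fin t → ZMod 2) → (Fin m → ZMod 2))
    (p q : Fin t × Fin m) :
    ∃ w : Fin t × Fin m → ZMod 2, w p ≠ 0 ∧ w q ≠ 0 ∧ hammingNorm w ≤ 4 ∧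
      ∀ c ∈ mollard C D φ, w + c ∈ mollard C D φ := by
  obtain ⟨k, hk, hk'⟩ := exists_other ht p.1 q.1
  obtain ⟨l, hl, hl'⟩ := exists_other hm p.2 q.2
  let u : Fin t → ZMod 2 := Pi.single p.1 1 + Pi.single k 1
  let v : Fin m → ZMod 2 := Pi.single p.2 1 + Pi.single l 1
  have hu1 : u p.1 = 1 := by simp [u, Pi.single_apply, hk.symm]
  have huk : u k = 1 := by simp [u, Pi.single_apply, hk]
  have hv1 : v p.2 = 1 := by simp [v, Pi.single_apply, hl.symm]
  have hvl : v l = 1 := by simp [v, Pi.single_apply, hl]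
  have huq : u q.1 = 1 := by rcases hk' with h | h <;> rw [h] <;> assumption
  have hvq : v q.2 = 1 := by rcases hl' with h | h <;> rw [h] <;> assumption
  have su : ∑ i, u i = 0 := by
    simp only [u, Pi.add_apply, Finset.sum_add_distrib, Finset.sum_pi_single']; simp; rfl
  have sv : ∑ i, v i = 0 := by
    simp only [v, Pi.add_apply, Finset.sum_add_distrib, Finset.sum_pi_single']; simp; rfl
  refine ⟨fun x => u x.1 * v x.2, ?_, ?_, ?_, ?_⟩
  · simp [hu1, hv1]
  · simp [huq, hvq]
  · have hsub : (Finset.univ.filter fun x : Fin t × Fin m => u x.1 * v x.2 ≠ 0) ⊆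
        ({p.1, k} : Finset (Fin t)) ×ˢ ({p.2, l} : Finset (Fin m)) := by
      rintro ⟨i, j⟩ hx
      simp only [Finset.mem_filter, Finset.mem_univ, true_and] at hx
      have h1 : u i ≠ 0 := left_ne_zero_of_mul hx
      have h2 : v j ≠ 0 := right_ne_zero_of_mul hx
      simp only [Finset.mem_product, Finset.mem_insert, Finset.mem_singleton]
      constructor
      · by_contra hc
        push Not at hc
        exact h1 (by simp [u, Pi.single_apply, hc.1, hc.2])
      · by_contra hc
        push Not at hc
        exact h2 (by simp [v, Pi.single_apply, hc.1, hc.2])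
    refine (Finset.card_le_card hsub).trans ?_
    rw [Finset.card_product]
    exact Nat.mul_le_mul Finset.card_le_two Finset.card_le_two
  · rintro c hc
    have e1 : (fun i => ∑ j, ((fun x : Fin t × Fin m => u x.1 * v x.2) + c) (i, j)) =
        fun i => ∑ j, c (i, j) := by
      funext i
      simp [Finset.sum_add_distrib, ← Finset.mul_sum, sv]
    have e2 : (fun j => ∑ i, ((fun x : Fin t × Fin m => u x.1 * v x.2) + c) (i, j)) =
        fun j => ∑ i, c (i, j) := by
      funext i
      simp [Finset.sum_add_distrib, ← Finset.sum_mul, su]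
    simp only [mollard, Set.mem_ofPred_eq] at hc ⊢
    rw [e1, e2]
    exact hc

theorem norm_comp {ι κ : Type} [Fintype ι] [Fintype κ] (e : ι ≃ κ) (z : κ → ZMod 2) :
    hammingNorm (fun i => z (e i)) = hammingNorm z := by
  simp only [hammingNorm, Finset.card_filter]
  exact Equiv.sum_comp e (fun k => if z k ≠ 0 then 1 else 0)

theorem not_mollard {V : Type} [AddCommGroup V] [Module (ZMod 2) V] [Fintype V]
    {τ : Equiv.Perm V} (h : Good τ) {t m : ℕ} (ht : 4 ≤ t) (hm : 4 ≤ m)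
    (C : Set (Fin t → ZMod 2)) (D : Set (Fin m → ZMod 2))
    (φ : (Fin t → ZMod 2) → (Fin m → ZMod 2)) : ¬ CodeIso (SC τ) (mollard C D φ) := by
  rintro ⟨e, x, hM⟩
  obtain ⟨w, hp, hq, hw, hk⟩ := mollard_kernel ht hm C D φ (e (Sum.inl 0)) (e (Sum.inr 0))
  have := kernel_big h (fun i => w (e i)) ?_ hp hq
  · rw [norm_comp] at this
    omega
  · intro c hc
    have h1 : (x + fun k => c (e.symm k)) ∈ mollard C D φ := by
      rw [← hM]; exact ⟨c, hc, rfl⟩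
    have h2 := hk _ h1
    rw [← hM] at h2
    obtain ⟨c', hc', he⟩ := h2
    have : (fun i => w (e i)) + c = c' := by
      funext i
      have hi := congrFun he (e i)
      simp only [Pi.add_apply, Equiv.symm_apply_apply] at hi
      have key : ∀ a b c d : ZMod 2, a + b = c + (a + d) → c + d = b := by decide
      exact key _ _ _ _ hi
    rw [this]
    exact hc'

end mollardside

section transport

variable {ι κ : Type} (e : ι ≃ κ)

/-- recoordelled code -/
def recoord (S : Set (ι → ZMod 2)) : Set (κ → ZMod 2) := {z | (fun i => z (e i)) ∈ S}

theorem extPerfect_recoord [Fintype ι] [Fintype κ] {S : Set (ι → ZMod 2)} (h : IsExtPerfect S) :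
    IsExtPerfect (recoord e S) := by
  have hd : ∀ x y : κ → ZMod 2,
      hammingDist x y = hammingDist (fun i => x (e i)) (fun i => y (e i)) := by
    intro x y
    rw [dist_eq_norm, dist_eq_norm, ← norm_comp e]; rfl
  obtain ⟨h1, ⟨x, hx, y, hy, hxy⟩, h3⟩ := h
  refine ⟨?_, ?_, ?_⟩
  · intro x hx y hy hne
    rw [hd]
    refine h1 _ hx _ hy fun heq => hne ?_
    funext k
    simpa using congrFun heq (e.symm k)
  · refine ⟨fun k => x (e.symm k), by simpa [recoord] using hx, fun k => y (e.symm k),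
      by simpa [recoord] using hy, ?_⟩
    rw [hd]
    simpa using hxy
  · have hc : Nat.card (recoord e S) = Nat.card S := by
      refine Nat.card_congr ⟨fun z => ⟨_, z.2⟩,
        fun z => ⟨fun k => z.1 (e.symm k), by simpa [recoord] using z.2⟩, ?_, ?_⟩
      · intro z; ext k; simp
      · intro z; ext k; simp
    rw [hc, ← Fintype.card_congr e]
    exact h3

theorem reach_recoord [Fintype κ] {S : Set (ι → ZMod 2)} {y y' : κ → ZMod 2}
    (h : Reach S (fun i => y (e i)) (fun i => y' (e i))) : Reach (recoord e S) y y' := by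
  obtain ⟨x, π, hS, hy⟩ := h
  have key : ∀ w : κ → ZMod 2, ∀ i, ((fun k => x (e.symm k)) +
      permAct ((e.symm.trans π).trans e) w) (e i) = (x + permAct π (fun i => w (e i))) i := by
    intro w i
    simp [permAct]
  refine ⟨fun k => x (e.symm k), (e.symm.trans π).trans e, image_eq _ _ ?_, ?_⟩
  · intro w hw
    change (fun i => _) ∈ S
    simp only [key]
    rw [← hS]
    exact ⟨_, hw, rfl⟩
  · funext k
    obtain ⟨i, rfl⟩ := e.surjective k
    rw [key, hy]

theorem nt_recoord [Fintype ι] [Fintype κ] {S : Set (ι → ZMod 2)} (h : NeighborTransitive S) :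
    NeighborTransitive (recoord e S) := by
  have hd : ∀ x y : κ → ZMod 2,
      hammingDist x y = hammingDist (fun i => x (e i)) (fun i => y (e i)) := by
    intro x y
    rw [dist_eq_norm, dist_eq_norm, ← norm_comp e]; rfl
  have hn : ∀ y ∈ codeNbrs (recoord e S), (fun i => y (e i)) ∈ codeNbrs S := by
    rintro y ⟨h1, c, hc, hdc⟩
    exact ⟨h1, _, hc, by rw [← hd]; exact hdc⟩
  exact ⟨fun c hc c' hc' => reach_recoord e (h.1 _ hc _ hc'),
    fun y hy y' hy' => reach_recoord e (h.2 _ (hn y hy) _ (hn y' hy'))⟩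

theorem codeIso_recoord {μ : Type} {S : Set (ι → ZMod 2)} {M : Set (μ → ZMod 2)}
    (h : CodeIso (recoord e S) M) : CodeIso S M := by
  obtain ⟨f, x, rfl⟩ := h
  refine ⟨e.trans f, x, ?_⟩
  ext z
  constructor
  · rintro ⟨c, hc, rfl⟩
    exact ⟨fun k => c (e.symm k), by simpa [recoord] using hc, rfl⟩
  · rintro ⟨c, hc, rfl⟩
    refine ⟨_, hc, ?_⟩
    simp

end transport

end NTNM

/-- for every `r ≥ 3`, `r ≠ 5`, there is a neighbor transitive extended
perfect binary code of length `2^{r+1}` that is non-Mollard. -/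
theorem exists_neighborTransitive_nonMollard (r : ℕ) (hr : 3 ≤ r) (hr5 : r ≠ 5) :
    ∃ C : Set (Fin (2 ^ (r + 1)) → ZMod 2),
      IsExtPerfect C ∧ NeighborTransitive C ∧
      ¬ ∃ (t m : ℕ) (C' : Set (Fin t → ZMod 2)) (D' : Set (Fin m → ZMod 2))
          (φ : (Fin t → ZMod 2) → (Fin m → ZMod 2)),
          IsExtPerfect C' ∧ IsExtPerfect D' ∧ CodeIso C (mollard C' D' φ) := by
  obtain ⟨V, _, _, _, τ, hc, h⟩ := NTNM.hasGood r hr hr5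
  have hcard : Fintype.card (V ⊕ V) = 2 ^ (r + 1) := by
    rw [Fintype.card_sum, hc, pow_succ]; ring
  let e : V ⊕ V ≃ Fin (2 ^ (r + 1)) := Fintype.equivFinOfCardEq hcard
  have hV : ∃ x : V, x ≠ 0 := by
    have : 1 < Fintype.card V := by
      rw [hc]; exact Nat.one_lt_two_pow (by omega)
    have : Nontrivial V := Fintype.one_lt_card_iff_nontrivial.1 this
    exact exists_ne 0
  refine ⟨NTNM.recoord e (NTNM.SC τ), NTNM.extPerfect_recoord e (NTNM.extPerfect_SC h.zero hV),
    NTNM.nt_recoord e (NTNM.nt_SC h), ?_⟩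
  rintro ⟨t, m, C', D', φ, hC, hD, hiso⟩
  exact NTNM.not_mollard h (NTNM.four_le hC) (NTNM.four_le hD) C' D' φ
    (NTNM.codeIso_recoord e hiso)
end
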